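/- Suppose the full-space MFN problem is feasible. Then the subspace MFN problem is feasible, all minimizers of the subspace MFN problem share a common Hessian Ĥ*, all minimizers of the full-space MFN problem share a common Hessian H*, and H* = Q Ĥ* Qᵀ. -/

import Mathlib

open Matrix

/-- Squared Frobenius norm of a real matrix. -/
noncomputable def frobSq {a b : ℕ} (A : Matrix (Fin a) (Fin b) ℝ) : ℝ :=
  ∑ i, ∑ j, (A i j) ^ 2

/-- Squared Euclidean norm of a real vector. -/
noncomputable def vecNormSq {a : ℕ} (v : Fin a → ℝ) : ℝ :=
  ∑ i, (v i) ^ 2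

/-- `v` lies in the orthogonal complement of the column space of `Q`. -/
def inColPerp {n d : ℕ} (Q : Matrix (Fin n) (Fin d) ℝ) (v : Fin n → ℝ) : Prop :=
  ∀ u : Fin d → ℝ, Q.mulVec u ⬝ᵥ v = 0

/-- Feasibility for the quadratic interpolation constraints: `p = (α, H)` with `H`
symmetric and `(dᵢ)ᵀ α + ½ (dᵢ)ᵀ H dᵢ = rhs i` for all `i`. -/
def QFeas {k m : ℕ} (dd : Fin m → Fin k → ℝ) (rhs : Fin m → ℝ)
    (p : (Fin k → ℝ) × Matrix (Fin k) (Fin k) ℝ) : Prop :=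
  p.2.IsSymm ∧ ∀ i, dd i ⬝ᵥ p.1 + (1 / 2) * (dd i ⬝ᵥ p.2.mulVec (dd i)) = rhs i

/-- Objective of the minimum norm (MN) problem. -/
noncomputable def MNObj {k : ℕ} (p : (Fin k → ℝ) × Matrix (Fin k) (Fin k) ℝ) : ℝ :=
  (1 / 2) * vecNormSq p.1 + (1 / 2) * frobSq p.2

/-- `p` is a minimizer of the MN problem. -/
def MNMin {k m : ℕ} (dd : Fin m → Fin k → ℝ) (rhs : Fin m → ℝ)
    (p : (Fin k → ℝ) × Matrix (Fin k) (Fin k) ℝ) : Prop :=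
  QFeas dd rhs p ∧ ∀ q, QFeas dd rhs q → MNObj p ≤ MNObj q

/-- Objective of the minimum Frobenius norm (MFN) problem. -/
noncomputable def MFNObj {k : ℕ} (p : (Fin k → ℝ) × Matrix (Fin k) (Fin k) ℝ) : ℝ :=
  (1 / 2) * frobSq p.2

/-- `p` is a minimizer of the MFN problem. -/
def MFNMin {k m : ℕ} (dd : Fin m → Fin k → ℝ) (rhs : Fin m → ℝ)
    (p : (Fin k → ℝ) × Matrix (Fin k) (Fin k) ℝ) : Prop :=
  QFeas dd rhs p ∧ ∀ q, QFeas dd rhs q → MFNObj p ≤ MFNObj q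

/-- Objective of the least Frobenius norm updating (LFU) problem. -/
noncomputable def LFUObj {k : ℕ} (Hbar : Matrix (Fin k) (Fin k) ℝ)
    (p : (Fin k → ℝ) × Matrix (Fin k) (Fin k) ℝ) : ℝ :=
  (1 / 2) * frobSq (p.2 - Hbar)

/-- `p` is a minimizer of the LFU problem with reference matrix `Hbar`. -/
def LFUMin {k m : ℕ} (dd : Fin m → Fin k → ℝ) (rhs : Fin m → ℝ)
    (Hbar : Matrix (Fin k) (Fin k) ℝ)
    (p : (Fin k → ℝ) × Matrix (Fin k) (Fin k) ℝ) : Prop :=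
  QFeas dd rhs p ∧ ∀ q, QFeas dd rhs q → LFUObj Hbar p ≤ LFUObj Hbar q

/-- `X` is a Moore–Penrose pseudoinverse of `A`. -/
def IsMPInv {a b : ℕ} (A : Matrix (Fin a) (Fin b) ℝ) (X : Matrix (Fin b) (Fin a) ℝ) : Prop :=
  A * X * A = A ∧ X * A * X = X ∧ (A * X)ᵀ = A * X ∧ (X * A)ᵀ = X * A

/-- The vector `δ_g(y⁰; W)` with `i`-th entry `g(y⁰ + wⁱ) − g(y⁰)`,
where `wⁱ` is the `i`-th column of `W`. -/
noncomputable def deltaVec {k p : ℕ} (g : (Fin k → ℝ) → ℝ) (y0 : Fin k → ℝ)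
    (W : Matrix (Fin k) (Fin p) ℝ) : Fin p → ℝ :=
  fun i => g (y0 + fun j => W j i) - g y0

theorem frobSq_eq_trace {a b : ℕ} (A : Matrix (Fin a) (Fin b) ℝ) :
    frobSq A = (Aᵀ * A).trace := by
  simp only [frobSq, Matrix.trace, Matrix.diag, Matrix.mul_apply, Matrix.transpose_apply, sq]
  exact Finset.sum_comm

theorem frobSq_nonneg {a b : ℕ} (A : Matrix (Fin a) (Fin b) ℝ) : 0 ≤ frobSq A :=
  Finset.sum_nonneg fun _ _ => Finset.sum_nonneg fun _ _ => sq_nonneg _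

theorem frobSq_transpose {a b : ℕ} (A : Matrix (Fin a) (Fin b) ℝ) : frobSq Aᵀ = frobSq A := by
  simp only [frobSq, Matrix.transpose_apply]
  exact Finset.sum_comm

theorem eq_zero_of_frobSq_nonpos {a b : ℕ} {A : Matrix (Fin a) (Fin b) ℝ} (h : frobSq A ≤ 0) :
    A = 0 := by
  have h0 : frobSq A = 0 := le_antisymm h (frobSq_nonneg A)
  ext i j
  have hi := (Finset.sum_eq_zero_iff_of_nonneg
    fun i _ => Finset.sum_nonneg fun j _ => sq_nonneg (A i j)).1 h0 i (Finset.mem_univ i)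
  have hj := (Finset.sum_eq_zero_iff_of_nonneg fun j _ => sq_nonneg (A i j)).1 hi j
    (Finset.mem_univ j)
  simpa using hj

theorem frobSq_parallelogram {a b : ℕ} (A B : Matrix (Fin a) (Fin b) ℝ) :
    frobSq A + frobSq B =
      2 * frobSq ((1 / 2 : ℝ) • (A + B)) + (1 / 2) * frobSq (A - B) := by
  simp only [frobSq, Finset.mul_sum, ← Finset.sum_add_distrib]
  refine Finset.sum_congr rfl fun i _ => Finset.sum_congr rfl fun j _ => ?_
  simp only [Matrix.smul_apply, Matrix.add_apply, Matrix.sub_apply, smul_eq_mul]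
  ring

section OrthonormalColumns

variable {n d : ℕ} {Q : Matrix (Fin n) (Fin d) ℝ}

theorem frobSq_mul_left (hQ : Qᵀ * Q = 1) {b : ℕ} (A : Matrix (Fin d) (Fin b) ℝ) :
    frobSq (Q * A) = frobSq A := by
  rw [frobSq_eq_trace, frobSq_eq_trace, Matrix.transpose_mul, Matrix.mul_assoc,
    ← Matrix.mul_assoc Qᵀ, hQ, Matrix.one_mul]

theorem frobSq_transpose_mul_le (hQ : Qᵀ * Q = 1) {b : ℕ} (A : Matrix (Fin n) (Fin b) ℝ) :
    frobSq (Qᵀ * A) ≤ frobSq A := by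
  have h : frobSq (A - Q * (Qᵀ * A)) = frobSq A - frobSq (Qᵀ * A) := by
    have hQQ : Qᵀ * (Q * (Qᵀ * A)) = Qᵀ * A := by
      rw [← Matrix.mul_assoc, hQ, Matrix.one_mul]
    simp only [frobSq_eq_trace, ← Matrix.trace_sub]
    congr 1
    simp only [Matrix.transpose_sub, Matrix.transpose_mul, Matrix.transpose_transpose,
      Matrix.sub_mul, Matrix.mul_sub, Matrix.mul_assoc, hQQ]
    abel
  linarith [frobSq_nonneg (A - Q * (Qᵀ * A))]

theorem frobSq_conj (hQ : Qᵀ * Q = 1) (A : Matrix (Fin d) (Fin d) ℝ) :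
    frobSq (Q * A * Qᵀ) = frobSq A := by
  rw [Matrix.mul_assoc, frobSq_mul_left hQ, ← frobSq_transpose, Matrix.transpose_mul,
    Matrix.transpose_transpose, frobSq_mul_left hQ, frobSq_transpose]

theorem frobSq_compression_le (hQ : Qᵀ * Q = 1) (A : Matrix (Fin n) (Fin n) ℝ) :
    frobSq (Qᵀ * A * Q) ≤ frobSq A := by
  rw [Matrix.mul_assoc]
  refine (frobSq_transpose_mul_le hQ _).trans ?_
  rw [← frobSq_transpose, Matrix.transpose_mul]
  exact (frobSq_transpose_mul_le hQ _).trans (frobSq_transpose A).le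

variable {m : ℕ} {dh : Fin m → Fin d → ℝ} {rhs : Fin m → ℝ}

theorem QFeas.compress {p : (Fin n → ℝ) × Matrix (Fin n) (Fin n) ℝ}
    (h : QFeas (fun i => Q.mulVec (dh i)) rhs p) :
    QFeas dh rhs (Qᵀ.mulVec p.1, Qᵀ * p.2 * Q) := by
  refine ⟨?_, fun i => ?_⟩
  · have hs : p.2ᵀ = p.2 := h.1
    simp [Matrix.IsSymm, Matrix.transpose_mul, hs, Matrix.mul_assoc]
  · rw [← h.2 i]
    simp only [← Matrix.mulVec_mulVec, Matrix.dotProduct_mulVec, Matrix.vecMul_transpose]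

theorem QFeas.lift (hQ : Qᵀ * Q = 1) {p : (Fin d → ℝ) × Matrix (Fin d) (Fin d) ℝ}
    (h : QFeas dh rhs p) :
    QFeas (fun i => Q.mulVec (dh i)) rhs (Q.mulVec p.1, Q * p.2 * Qᵀ) := by
  refine ⟨?_, fun i => ?_⟩
  · have hs : p.2ᵀ = p.2 := h.1
    simp [Matrix.IsSymm, Matrix.transpose_mul, hs, Matrix.mul_assoc]
  · have hv (v : Fin d → ℝ) : Qᵀ.mulVec (Q.mulVec v) = v := by
      rw [Matrix.mulVec_mulVec, hQ, Matrix.one_mulVec]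
    have hdot (v w : Fin d → ℝ) : Q.mulVec v ⬝ᵥ Q.mulVec w = v ⬝ᵥ w := by
      rw [Matrix.dotProduct_mulVec, ← Matrix.mulVec_transpose, hv]
    rw [← h.2 i]
    simp only [← Matrix.mulVec_mulVec, hv, hdot]

/-- Lifting a subspace minimizer along a matrix with orthonormal columns gives a full-space
minimizer. -/
theorem MFNMin.lift (hQ : Qᵀ * Q = 1) {p : (Fin d → ℝ) × Matrix (Fin d) (Fin d) ℝ}
    (h : MFNMin dh rhs p) :
    MFNMin (fun i => Q.mulVec (dh i)) rhs (Q.mulVec p.1, Q * p.2 * Qᵀ) := by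
  refine ⟨h.1.lift hQ, fun q hq => ?_⟩
  have hle := h.2 _ hq.compress
  have hcomp := frobSq_compression_le hQ q.2
  simp only [MFNObj, frobSq_conj hQ] at hle ⊢
  linarith

end OrthonormalColumns

section Minimizers

variable {k m : ℕ} {dd : Fin m → Fin k → ℝ} {rhs : Fin m → ℝ}

theorem MFNMin.hessian_eq {p q : (Fin k → ℝ) × Matrix (Fin k) (Fin k) ℝ}
    (hp : MFNMin dd rhs p) (hq : MFNMin dd rhs q) : p.2 = q.2 := by
  have hmid : QFeas dd rhs ((1 / 2 : ℝ) • (p.1 + q.1), (1 / 2 : ℝ) • (p.2 + q.2)) := by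
    refine ⟨(hp.1.1.add hq.1.1).smul _, fun i => ?_⟩
    have h1 := hp.1.2 i
    have h2 := hq.1.2 i
    simp only [Matrix.smul_mulVec, Matrix.add_mulVec, dotProduct_smul, dotProduct_add,
      smul_eq_mul]
    linarith
  have h1 := hp.2 _ hmid
  have h2 := hq.2 _ hmid
  have h3 := frobSq_parallelogram p.2 q.2
  simp only [MFNObj] at h1 h2
  exact sub_eq_zero.1 (eq_zero_of_frobSq_nonpos (by linarith))

/-- The symmetric matrices that solve, with a suitable linear term, the homogeneous
interpolation constraints. -/
def homogeneousHessians (dd : Fin m → Fin k → ℝ) : Submodule ℝ (Matrix (Fin k) (Fin k) ℝ) where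
  carrier := {H | ∃ α, QFeas dd 0 (α, H)}
  zero_mem' := ⟨0, Matrix.isSymm_zero, fun i => by simp⟩
  add_mem' := by
    rintro H K ⟨α, hα⟩ ⟨β, hβ⟩
    refine ⟨α + β, hα.1.add hβ.1, fun i => ?_⟩
    have h1 := hα.2 i
    have h2 := hβ.2 i
    simp only [Matrix.add_mulVec, dotProduct_add, Pi.zero_apply] at h1 h2 ⊢
    linarith
  smul_mem' := by
    rintro c H ⟨α, hα⟩
    refine ⟨c • α, hα.1.smul c, fun i => ?_⟩
    have h1 := hα.2 i
    simp only [Matrix.smul_mulVec, dotProduct_smul, smul_eq_mul, Pi.zero_apply] at h1 ⊢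
    linear_combination c * h1

theorem QFeas.sub {p q : (Fin k → ℝ) × Matrix (Fin k) (Fin k) ℝ}
    (hp : QFeas dd rhs p) (hq : QFeas dd rhs q) : QFeas dd 0 (p.1 - q.1, p.2 - q.2) := by
  refine ⟨hp.1.sub hq.1, fun i => ?_⟩
  have h1 := hp.2 i
  have h2 := hq.2 i
  simp only [Matrix.sub_mulVec, dotProduct_sub, Pi.zero_apply]
  linarith

theorem QFeas.sub_homogeneous {p q : (Fin k → ℝ) × Matrix (Fin k) (Fin k) ℝ}
    (hp : QFeas dd rhs p) (hq : QFeas dd 0 q) : QFeas dd rhs (p.1 - q.1, p.2 - q.2) := by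
  refine ⟨hp.1.sub hq.1, fun i => ?_⟩
  have h1 := hp.2 i
  have h2 := hq.2 i
  simp only [Matrix.sub_mulVec, dotProduct_sub, Pi.zero_apply] at h2 ⊢
  linarith

open scoped Matrix.Norms.Frobenius

theorem frobSq_eq_norm_sq (A : Matrix (Fin k) (Fin k) ℝ) : frobSq A = ‖A‖ ^ 2 := by
  rw [Matrix.frobenius_norm_def, ← Real.sqrt_eq_rpow, Real.sq_sqrt]
  · simp [frobSq]
  · positivity

theorem exists_MFNMin (hfeas : ∃ p, QFeas dd rhs p) : ∃ p, MFNMin dd rhs p := by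
  obtain ⟨p, hp⟩ := hfeas
  have : ProperSpace (Matrix (Fin k) (Fin k) ℝ) := FiniteDimensional.proper_real _
  obtain ⟨K, ⟨β, hβ⟩, hK⟩ :=
    (homogeneousHessians dd).closed_of_finiteDimensional.exists_infDist_eq_dist
      ⟨0, (homogeneousHessians dd).zero_mem⟩ p.2
  refine ⟨_, hp.sub_homogeneous hβ, fun q hq => ?_⟩
  have hmem : p.2 - q.2 ∈ (homogeneousHessians dd : Set (Matrix (Fin k) (Fin k) ℝ)) :=
    ⟨_, hp.sub hq⟩
  have hle := Metric.infDist_le_dist_of_mem (x := p.2) hmem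
  rw [hK, dist_eq_norm, dist_eq_norm, sub_sub_cancel] at hle
  simp only [MFNObj, frobSq_eq_norm_sq]
  gcongr

end Minimizers

/-- If the full-space MFN problem is feasible, then the subspace MFN
problem is feasible, all minimizers of the subspace problem share a common Hessian
`Ĥ*`, all minimizers of the full-space problem share a common Hessian `H*`, and
`H* = Q Ĥ* Qᵀ`. -/
theorem stmt_4 {n d m : ℕ} (hn : 0 < n) (hd : 0 < d) (hm : 0 < m) (hdn : d < n)
    (Q : Matrix (Fin n) (Fin d) ℝ) (hQ : Qᵀ * Q = 1)
    (f : (Fin n → ℝ) → ℝ) (x0 : Fin n → ℝ) (dh : Fin m → Fin d → ℝ)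
    (fh : (Fin d → ℝ) → ℝ) (hfh : ∀ xh, fh xh = f (x0 + Q.mulVec xh))
    (hfeas : ∃ p, QFeas (fun i => Q.mulVec (dh i))
      (fun i => f (x0 + Q.mulVec (dh i)) - f x0) p) :
    (∃ p, QFeas dh (fun i => fh (dh i) - fh 0) p) ∧
    ∃ (Hhs : Matrix (Fin d) (Fin d) ℝ) (Hs : Matrix (Fin n) (Fin n) ℝ),
      (∃ αh, MFNMin dh (fun i => fh (dh i) - fh 0) (αh, Hhs)) ∧
      (∀ p, MFNMin dh (fun i => fh (dh i) - fh 0) p → p.2 = Hhs) ∧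
      (∃ α, MFNMin (fun i => Q.mulVec (dh i))
        (fun i => f (x0 + Q.mulVec (dh i)) - f x0) (α, Hs)) ∧
      (∀ p, MFNMin (fun i => Q.mulVec (dh i))
        (fun i => f (x0 + Q.mulVec (dh i)) - f x0) p → p.2 = Hs) ∧
      Hs = Q * Hhs * Qᵀ := by
  have hrhs : (fun i => fh (dh i) - fh 0) = fun i => f (x0 + Q.mulVec (dh i)) - f x0 := by
    simp [hfh]
  rw [hrhs]
  obtain ⟨p, hp⟩ := hfeas
  obtain ⟨⟨αh, Hh⟩, hmin⟩ := exists_MFNMin ⟨_, hp.compress⟩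
  exact ⟨⟨_, hp.compress⟩, Hh, Q * Hh * Qᵀ, ⟨αh, hmin⟩, fun _ h => h.hessian_eq hmin,
    ⟨_, hmin.lift hQ⟩, fun _ h => h.hessian_eq (hmin.lift hQ), rfl⟩
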